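/- For G = ES_2(p,n) and g ∈ G, the endomorphism semigroup image {σ(g) : σ ∈ End(G)} equals: {e} if g = e; Z(G) if g ∈ Z(G)∖{e}; H if g ∈ H∖Z(G); and all of G if g ∈ G∖H. In particular these images have cardinalities 1, p, p^{2n} and p^{2n+1} respectively. -/

import Mathlib

open Matrix

/-- The additive embedding `ℤ/pℤ → ℤ/p²ℤ`, `a ↦ p·a`. -/
def emb (p : ℕ) (a : ZMod p) : ZMod (p ^ 2) := (p : ZMod (p ^ 2)) * (a.val : ZMod (p ^ 2))

/-- Reduction modulo `p`, `ℤ/p²ℤ → ℤ/pℤ`. -/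
def red (p : ℕ) : ZMod (p ^ 2) →+* ZMod p :=
  ZMod.castHom (dvd_pow_self p (by norm_num)) (ZMod p)

section EmbLemmas

variable {p : ℕ} [NeZero p]

theorem emb_sq_zero : (p : ZMod (p ^ 2)) * (p : ZMod (p ^ 2)) = 0 := by
  have h : ((p ^ 2 : ℕ) : ZMod (p ^ 2)) = 0 := ZMod.natCast_self _
  push_cast at h
  linear_combination h

theorem emb_mod (k : ℕ) :
    (p : ZMod (p ^ 2)) * ((k % p : ℕ) : ZMod (p ^ 2)) = (p : ZMod (p ^ 2)) * (k : ℕ) := by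
  conv_rhs => rw [← Nat.div_add_mod k p]
  push_cast
  linear_combination (-((k / p : ℕ) : ZMod (p ^ 2))) * emb_sq_zero (p := p)

theorem emb_add (a b : ZMod p) : emb p (a + b) = emb p a + emb p b := by
  unfold emb
  rw [ZMod.val_add, emb_mod]
  push_cast
  ring

theorem emb_zero : emb p (0 : ZMod p) = 0 := by
  simp [emb]

theorem emb_neg (a : ZMod p) : emb p (-a) = -emb p a := by
  have h := emb_add (p := p) (-a) a
  rw [neg_add_cancel, emb_zero] at h
  exact eq_neg_of_add_eq_zero_left h.symm

theorem emb_sub (a b : ZMod p) : emb p (a - b) = emb p a - emb p b := by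
  rw [sub_eq_add_neg, emb_add, emb_neg]; ring

theorem emb_mul_emb (a b : ZMod p) : emb p a * emb p b = 0 := by
  unfold emb
  calc (p : ZMod (p ^ 2)) * (a.val : ZMod (p ^ 2)) * ((p : ZMod (p ^ 2)) * (b.val : ZMod (p ^ 2)))
      = ((p : ZMod (p^2)) * (p : ZMod (p^2))) * ((a.val : ZMod (p ^ 2)) * (b.val : ZMod (p ^ 2))) := by ring
    _ = 0 := by rw [emb_sq_zero]; ring

theorem red_emb (a : ZMod p) : red p (emb p a) = 0 := by
  unfold emb
  rw [_root_.map_mul, map_natCast, ZMod.natCast_self]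
  ring

end EmbLemmas

/-- The extra-special `p`-group of exponent `p²` and order `p^(2(m+1)+1)`
(so `n = m + 1` in the paper's notation). -/
@[ext]
structure ES2 (p m : ℕ) : Type where
  u1 : ZMod (p ^ 2)
  u : Fin m → ZMod p
  w1 : ZMod p
  w : Fin m → ZMod p

namespace ES2

variable {p m : ℕ}

instance : Mul (ES2 p m) :=
  ⟨fun x y => ⟨x.u1 + y.u1 + emb p y.w1 * x.u1 + emb p (x.u ⬝ᵥ y.w),
    x.u + y.u, x.w1 + y.w1, x.w + y.w⟩⟩

@[simp] theorem mul_u1 (x y : ES2 p m) :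
    (x * y).u1 = x.u1 + y.u1 + emb p y.w1 * x.u1 + emb p (x.u ⬝ᵥ y.w) := rfl
@[simp] theorem mul_u (x y : ES2 p m) : (x * y).u = x.u + y.u := rfl
@[simp] theorem mul_w1 (x y : ES2 p m) : (x * y).w1 = x.w1 + y.w1 := rfl
@[simp] theorem mul_w (x y : ES2 p m) : (x * y).w = x.w + y.w := rfl

instance : One (ES2 p m) := ⟨⟨0, 0, 0, 0⟩⟩

@[simp] theorem one_u1 : (1 : ES2 p m).u1 = 0 := rfl
@[simp] theorem one_u : (1 : ES2 p m).u = 0 := rfl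
@[simp] theorem one_w1 : (1 : ES2 p m).w1 = 0 := rfl
@[simp] theorem one_w : (1 : ES2 p m).w = 0 := rfl

instance : Inv (ES2 p m) :=
  ⟨fun x => ⟨(1 - emb p x.w1) * (-x.u1 + emb p (x.u ⬝ᵥ x.w)), -x.u, -x.w1, -x.w⟩⟩

@[simp] theorem inv_u1 (x : ES2 p m) :
    (x⁻¹).u1 = (1 - emb p x.w1) * (-x.u1 + emb p (x.u ⬝ᵥ x.w)) := rfl
@[simp] theorem inv_u (x : ES2 p m) : (x⁻¹).u = -x.u := rfl
@[simp] theorem inv_w1 (x : ES2 p m) : (x⁻¹).w1 = -x.w1 := rfl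
@[simp] theorem inv_w (x : ES2 p m) : (x⁻¹).w = -x.w := rfl

instance [NeZero p] : Group (ES2 p m) :=
  Group.ofLeftAxioms
    (fun a b c => by
      ext
      · simp only [mul_u1, mul_u, mul_w1, mul_w, add_dotProduct, dotProduct_add, emb_add]
        linear_combination a.u1 * emb_mul_emb c.w1 b.w1 +
          emb_mul_emb c.w1 (a.u ⬝ᵥ b.w)
      · simp [add_assoc]
      · simp [add_assoc]
      · simp [add_assoc])
    (fun a => by
      ext <;> simp [emb_zero])
    (fun a => by
      ext
      · simp only [mul_u1, inv_u1, inv_u, inv_w1, inv_w, one_u1, neg_dotProduct, emb_neg]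
        linear_combination (a.u1 - emb p (a.u ⬝ᵥ a.w)) * emb_mul_emb a.w1 a.w1
      · simp
      · simp
      · simp)

end ES2

/-- The center `Z(G) = p(ℤ/p²ℤ) × 0 × 0 × 0` of `ES2 p m`. -/
def ZsetES2 (p m : ℕ) : Set (ES2 p m) :=
  {x | (∃ c : ZMod (p ^ 2), x.u1 = (p : ZMod (p ^ 2)) * c) ∧ x.u = 0 ∧ x.w1 = 0 ∧ x.w = 0}

/-- The subgroup `H = p(ℤ/p²ℤ) × (ℤ/pℤ)^m × (ℤ/pℤ) × (ℤ/pℤ)^m` of elements of order dividing `p`. -/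
def HsetES2 (p m : ℕ) : Set (ES2 p m) :=
  {x | ∃ c : ZMod (p ^ 2), x.u1 = (p : ZMod (p ^ 2)) * c}

/-- The subgroup `K = Z(H) = p(ℤ/p²ℤ) × 0 × (ℤ/pℤ) × 0` of `ES2 p m`. -/
def KsetES2 (p m : ℕ) : Set (ES2 p m) :=
  {x | (∃ c : ZMod (p ^ 2), x.u1 = (p : ZMod (p ^ 2)) * c) ∧ x.u = 0 ∧ x.w = 0}


section Aux

variable {p : ℕ} [Fact p.Prime]

theorem p_mul_eq_emb (x : ZMod (p ^ 2)) : (p : ZMod (p ^ 2)) * x = emb p (red p x) := by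
  obtain ⟨k, rfl⟩ := ZMod.natCast_zmod_surjective x
  unfold emb
  rw [map_natCast, ZMod.val_natCast, emb_mod]

theorem emb_mul_eq (a : ZMod p) (x : ZMod (p ^ 2)) : emb p a * x = emb p (a * red p x) := by
  have h : emb p a * x = (p : ZMod (p ^ 2)) * ((a.val : ZMod (p ^ 2)) * x) := by
    unfold emb; ring
  rw [h, p_mul_eq_emb, _root_.map_mul, map_natCast, ZMod.natCast_zmod_val]

theorem emb_inj {a b : ZMod p} (h : emb p a = emb p b) : a = b := by
  rw [← sub_eq_zero] at h ⊢
  rw [← emb_sub] at h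
  generalize a - b = c at *
  unfold emb at h
  have hp : 0 < p := (Fact.out : p.Prime).pos
  rw [← Nat.cast_mul, ZMod.natCast_eq_zero_iff, pow_two] at h
  have h2 := Nat.dvd_of_mul_dvd_mul_left hp h
  have h3 : c.val = 0 := Nat.eq_zero_of_dvd_of_lt h2 (ZMod.val_lt c)
  exact (ZMod.val_eq_zero c).1 h3

theorem red_surj (a : ZMod p) : ∃ x, red p x = a := by
  refine ⟨(a.val : ZMod (p ^ 2)), ?_⟩
  rw [map_natCast, ZMod.natCast_zmod_val]

theorem exists_p_mul_iff (x : ZMod (p ^ 2)) :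
    (∃ c, x = (p : ZMod (p ^ 2)) * c) ↔ red p x = 0 := by
  constructor
  · rintro ⟨c, rfl⟩
    rw [p_mul_eq_emb, red_emb]
  · obtain ⟨k, rfl⟩ := ZMod.natCast_zmod_surjective x
    intro h
    rw [map_natCast, ZMod.natCast_eq_zero_iff] at h
    obtain ⟨c, rfl⟩ := h
    exact ⟨c, by push_cast; rfl⟩

theorem exists_emb_of_red {x : ZMod (p ^ 2)} (h : red p x = 0) : ∃ c, x = emb p c := by
  obtain ⟨c, rfl⟩ := (exists_p_mul_iff x).2 h
  exact ⟨_, p_mul_eq_emb c⟩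

theorem two_ne_zero_of_odd (hodd : Odd p) : (2 : ZMod p) ≠ 0 := by
  have : ((2 : ℕ) : ZMod p) ≠ 0 := by
    rw [Ne, ZMod.natCast_eq_zero_iff]
    intro h
    have := (Nat.prime_dvd_prime_iff_eq (Fact.out : p.Prime) Nat.prime_two).1 h
    subst this
    exact absurd hodd (by decide)
  exact_mod_cast this

theorem isUnit_of_red {x : ZMod (p ^ 2)} (h : red p x ≠ 0) : IsUnit x := by
  obtain ⟨k, rfl⟩ := ZMod.natCast_zmod_surjective x
  rw [map_natCast, Ne, ZMod.natCast_eq_zero_iff] at h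
  rw [ZMod.isUnit_iff_coprime]
  exact (((Nat.Prime.coprime_iff_not_dvd Fact.out).2 h).symm).pow_right 2

end Aux

namespace ES2

variable {p m : ℕ} [Fact p.Prime]

theorem mem_H_iff (x : ES2 p m) : x ∈ HsetES2 p m ↔ red p x.u1 = 0 := exists_p_mul_iff _

theorem mem_Z_iff (x : ES2 p m) :
    x ∈ ZsetES2 p m ↔ red p x.u1 = 0 ∧ x.u = 0 ∧ x.w1 = 0 ∧ x.w = 0 := by
  unfold ZsetES2
  rw [Set.mem_ofPred_eq, exists_p_mul_iff]

theorem mul_red (x y : ES2 p m) : red p (x * y).u1 = red p x.u1 + red p y.u1 := by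
  rw [mul_u1, _root_.map_add, _root_.map_add, _root_.map_add, _root_.map_mul, red_emb, red_emb]
  ring

theorem pow_red (x : ES2 p m) (k : ℕ) : red p (x ^ k).u1 = k * red p x.u1 := by
  induction k with
  | zero => simp
  | succ k ih => rw [pow_succ x k, mul_red, ih]; push_cast; ring

theorem pow_u (x : ES2 p m) (k : ℕ) : (x ^ k).u = (k : ZMod p) • x.u := by
  induction k with
  | zero => simp
  | succ k ih => rw [pow_succ, mul_u, ih]; push_cast; rw [add_smul, one_smul]

theorem pow_w1 (x : ES2 p m) (k : ℕ) : (x ^ k).w1 = (k : ZMod p) * x.w1 := by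
  induction k with
  | zero => simp
  | succ k ih => rw [pow_succ, mul_w1, ih]; push_cast; ring

theorem pow_w (x : ES2 p m) (k : ℕ) : (x ^ k).w = (k : ZMod p) • x.w := by
  induction k with
  | zero => simp
  | succ k ih => rw [pow_succ, mul_w, ih]; push_cast; rw [add_smul, one_smul]

theorem pow_u1 (x : ES2 p m) (k : ℕ) :
    (x ^ k).u1 = k * x.u1 + emb p ((k.choose 2 : ℕ) * (x.w1 * red p x.u1 + x.u ⬝ᵥ x.w)) := by
  induction k with
  | zero => simp [emb_zero]
  | succ k ih =>
    rw [pow_succ x k, mul_u1, emb_mul_eq, pow_red, pow_u, ih, Nat.choose_succ_succ' k 1,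
      smul_dotProduct, smul_eq_mul, Nat.choose_one_right]
    push_cast
    rw [show ((k : ZMod p) + (k.choose 2 : ℕ)) * (x.w1 * red p x.u1 + x.u ⬝ᵥ x.w)
      = (k.choose 2 : ℕ) * (x.w1 * red p x.u1 + x.u ⬝ᵥ x.w) + x.w1 * (k * red p x.u1)
        + k * (x.u ⬝ᵥ x.w) by ring, emb_add, emb_add]
    ring

theorem pow_p (hodd : Odd p) (x : ES2 p m) : x ^ p = ⟨emb p (red p x.u1), 0, 0, 0⟩ := by
  have hc : ((p.choose 2 : ℕ) : ZMod p) = 0 := by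
    rw [ZMod.natCast_eq_zero_iff]
    apply Nat.Prime.dvd_choose_self Fact.out (by norm_num)
    have h2 := (Fact.out : p.Prime).two_le
    rcases h2.lt_or_eq with h | h
    · exact h
    · rw [← h] at hodd; exact absurd hodd (by decide)
  ext1
  · rw [pow_u1, hc, zero_mul, emb_zero, add_zero, p_mul_eq_emb]
  · rw [pow_u]; simp
  · rw [pow_w1]; simp
  · rw [pow_w]; simp

theorem mem_H_iff_pow (hodd : Odd p) (x : ES2 p m) : x ∈ HsetES2 p m ↔ x ^ p = 1 := by
  rw [mem_H_iff, pow_p hodd]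
  constructor
  · intro h; rw [h, emb_zero]; rfl
  · intro h
    have := congrArg ES2.u1 h
    simp only [one_u1] at this
    rw [← emb_zero (p := p)] at this
    exact emb_inj this

theorem exists_hom_of_functional (hodd : Odd p) (f : ES2 p m → ZMod p)
    (hf : ∀ x y, f (x * y) = f x + f y) {g h : ES2 p m} (hg : f g ≠ 0)
    (hh : h ∈ HsetES2 p m) : ∃ σ : ES2 p m →* ES2 p m, σ g = h := by
  have hp : h ^ p = 1 := (mem_H_iff_pow hodd h).1 hh
  refine ⟨MonoidHom.mk' (fun x => h ^ (f x * (f g)⁻¹).val) ?_, ?_⟩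
  · intro x y
    rw [hf, add_mul, ZMod.val_add, ← pow_eq_pow_mod _ hp, pow_add]
  · have : Fact (1 < p) := ⟨(Fact.out : p.Prime).one_lt⟩
    simp [mul_inv_cancel₀ hg, ZMod.val_one]

/-- Scaling. -/
def homA (k : ZMod (p ^ 2)) : ES2 p m →* ES2 p m :=
  MonoidHom.mk' (fun x => ⟨k * x.u1, red p k • x.u, x.w1, x.w⟩) (by
    intro x y
    ext1
    · simp only [mul_u1, smul_dotProduct, smul_eq_mul]
      rw [mul_comm (red p k), ← emb_mul_eq]
      ring
    · simp
    · rfl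
    · rfl)

/-- Transvection along `w1`. -/
def homC1 (hodd : Odd p) (t : ZMod p) : ES2 p m →* ES2 p m :=
  MonoidHom.mk' (fun x => ⟨x.u1 + emb p (t * 2⁻¹ * red p x.u1 ^ 2), x.u,
      x.w1 + t * red p x.u1, x.w⟩) (by
    intro x y
    have h2 := two_ne_zero_of_odd hodd
    ext1
    · simp only [mul_u1, emb_mul_eq, _root_.map_add, red_emb, add_zero]
      have key : t * 2⁻¹ * (red p x.u1 + red p y.u1) ^ 2
          = t * 2⁻¹ * red p x.u1 ^ 2 + t * 2⁻¹ * red p y.u1 ^ 2 + t * red p y.u1 * red p x.u1 := by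
        field_simp
        ring
      rw [key, add_mul]
      simp only [emb_add]
      ring
    · rfl
    · simp only [mul_red, mul_w1]; ring
    · rfl)

/-- Transvection along `u`. -/
def homC2 (v : Fin m → ZMod p) : ES2 p m →* ES2 p m :=
  MonoidHom.mk' (fun x => ⟨x.u1, x.u + red p x.u1 • v, x.w1 - v ⬝ᵥ x.w, x.w⟩) (by
    intro x y
    ext1
    · simp only [mul_u1, emb_mul_eq, add_assoc, ← emb_add, add_dotProduct, smul_dotProduct,
        smul_eq_mul]
      congr 3
      ring
    · simp only [mul_red, mul_u, add_smul]; abel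
    · simp only [mul_w, mul_w1, dotProduct_add]; ring
    · rfl)

/-- Transvection along `w`. -/
def homC3 (s : Fin m → ZMod p) : ES2 p m →* ES2 p m :=
  MonoidHom.mk' (fun x => ⟨x.u1 + emb p (red p x.u1 * (x.u ⬝ᵥ s)), x.u,
      x.w1 + x.u ⬝ᵥ s, x.w + red p x.u1 • s⟩) (by
    intro x y
    ext1
    · simp only [mul_u1, mul_u, emb_mul_eq, _root_.map_add, red_emb, add_dotProduct,
        dotProduct_add, dotProduct_smul, smul_eq_mul, add_zero, mul_add, add_mul, mul_zero, emb_add, emb_zero]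
      rw [mul_comm (y.u ⬝ᵥ s) (red p x.u1)]
      ring
    · rfl
    · simp only [mul_u, mul_w1, add_dotProduct]; ring
    · simp only [mul_red, mul_w, add_smul]; abel)

/-- Mutual reachability under endomorphisms. -/
def Reach (g h : ES2 p m) : Prop :=
  (∃ σ : ES2 p m →* ES2 p m, σ g = h) ∧ (∃ σ : ES2 p m →* ES2 p m, σ h = g)

theorem Reach.trans {a b c : ES2 p m} (h : Reach a b) (k : Reach b c) : Reach a c := by
  obtain ⟨⟨s, rfl⟩, ⟨t, ht⟩⟩ := h
  obtain ⟨⟨s', rfl⟩, ⟨t', ht'⟩⟩ := k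
  exact ⟨⟨s'.comp s, rfl⟩, ⟨t.comp t', by simp [ht', ht]⟩⟩

theorem reachA (k : (ZMod (p ^ 2))ˣ) (g : ES2 p m) : Reach g (homA (k : ZMod (p ^ 2)) g) := by
  refine ⟨⟨_, rfl⟩, ⟨homA ((k⁻¹ : (ZMod (p ^ 2))ˣ) : ZMod (p ^ 2)), ?_⟩⟩
  ext1
  · simp [homA]
  · have h : red p ((k⁻¹ : (ZMod (p ^ 2))ˣ) : ZMod (p ^ 2)) * red p (k : ZMod (p ^ 2)) = 1 := by
      rw [← _root_.map_mul, Units.inv_mul, _root_.map_one]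
    simp only [homA, MonoidHom.mk'_apply, smul_smul, h, one_smul]
  · rfl
  · rfl

theorem reachC1 (hodd : Odd p) (t : ZMod p) (g : ES2 p m) : Reach g (homC1 hodd t g) := by
  refine ⟨⟨_, rfl⟩, ⟨homC1 hodd (-t), ?_⟩⟩
  ext1
  · simp [homC1, red_emb, emb_neg]
  · rfl
  · simp [homC1, red_emb]
  · rfl

theorem reachC2 (v : Fin m → ZMod p) (g : ES2 p m) : Reach g (homC2 v g) := by
  refine ⟨⟨_, rfl⟩, ⟨homC2 (-v), ?_⟩⟩
  ext1
  · rfl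
  · simp [homC2]
  · simp [homC2]
  · rfl

theorem reachC3 (s : Fin m → ZMod p) (g : ES2 p m) : Reach g (homC3 s g) := by
  refine ⟨⟨_, rfl⟩, ⟨homC3 (-s), ?_⟩⟩
  ext1
  · simp [homC3, red_emb, emb_neg]
  · rfl
  · simp [homC3]
  · simp [homC3, red_emb]

theorem reach_one (hodd : Odd p) (g : ES2 p m) (hg : red p g.u1 ≠ 0) :
    Reach g ⟨1, 0, 0, 0⟩ := by
  -- kill u
  obtain ⟨g1, r1, hg1, h1u⟩ : ∃ g1, Reach g g1 ∧ red p g1.u1 ≠ 0 ∧ g1.u = 0 := by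
    refine ⟨_, reachC2 (-((red p g.u1)⁻¹ • g.u)) g, hg, ?_⟩
    simp [homC2, smul_smul, mul_inv_cancel₀ hg]
  obtain ⟨g2, r2, hg2, h2u, h2w⟩ :
      ∃ g2, Reach g1 g2 ∧ red p g2.u1 ≠ 0 ∧ g2.u = 0 ∧ g2.w = 0 := by
    refine ⟨_, reachC3 (-((red p g1.u1)⁻¹ • g1.w)) g1, ?_, h1u, ?_⟩
    · simpa [homC3, red_emb] using hg1
    · simp [homC3, smul_smul, mul_inv_cancel₀ hg1]
  obtain ⟨g3, r3, hg3, h3u, h3w, h3w1⟩ :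
      ∃ g3, Reach g2 g3 ∧ red p g3.u1 ≠ 0 ∧ g3.u = 0 ∧ g3.w = 0 ∧ g3.w1 = 0 := by
    refine ⟨_, reachC1 hodd (-(g2.w1 * (red p g2.u1)⁻¹)) g2, ?_, h2u, h2w, ?_⟩
    · simpa [homC1, red_emb] using hg2
    · simp [homC1, inv_mul_cancel_right₀ hg2]
  obtain ⟨k, hk⟩ := isUnit_of_red hg3
  have r4 := reachA k⁻¹ g3
  have : homA ((k⁻¹ : (ZMod (p ^ 2))ˣ) : ZMod (p ^ 2)) g3 = ⟨1, 0, 0, 0⟩ := by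
    ext1
    · simp [homA, ← hk]
    · simp [homA, h3u]
    · exact h3w1
    · exact h3w
  rw [this] at r4
  exact ((r1.trans r2).trans r3).trans r4

/-- Coordinates. -/
def coordEquiv : ES2 p m ≃ ZMod (p ^ 2) × (Fin m → ZMod p) × ZMod p × (Fin m → ZMod p) where
  toFun x := (x.u1, x.u, x.w1, x.w)
  invFun y := ⟨y.1, y.2.1, y.2.2.1, y.2.2.2⟩
  left_inv _ := rfl
  right_inv _ := rfl

theorem card_G : Nat.card (ES2 p m) = p ^ (2 * (m + 1) + 1) := by
  rw [Nat.card_congr coordEquiv]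
  simp only [Nat.card_prod, Nat.card_zmod, Nat.card_fun, Nat.card_fin]
  ring

theorem card_H : Nat.card (HsetES2 p m) = p ^ (2 * (m + 1)) := by
  let F : ZMod p × (Fin m → ZMod p) × ZMod p × (Fin m → ZMod p) → HsetES2 p m :=
    fun y => ⟨⟨emb p y.1, y.2.1, y.2.2.1, y.2.2.2⟩, (mem_H_iff _).2 (red_emb _)⟩
  have hF : Function.Bijective F := by
    constructor
    · rintro ⟨a, b, c, d⟩ ⟨a', b', c', d'⟩ h
      have h' := congrArg Subtype.val h
      simp only [F, ES2.mk.injEq] at h'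
      obtain ⟨h1, rfl, rfl, rfl⟩ := h'
      rw [emb_inj h1]
    · rintro ⟨⟨a, b, c, d⟩, hx⟩
      obtain ⟨e, rfl⟩ := exists_emb_of_red ((mem_H_iff _).1 hx)
      exact ⟨(e, b, c, d), rfl⟩
  rw [← Nat.card_congr (Equiv.ofBijective F hF)]
  simp only [Nat.card_prod, Nat.card_zmod, Nat.card_fun, Nat.card_fin]
  ring

theorem card_Z : Nat.card (ZsetES2 p m) = p := by
  let F : ZMod p → ZsetES2 p m :=
    fun y => ⟨⟨emb p y, 0, 0, 0⟩, (mem_Z_iff _).2 ⟨red_emb _, rfl, rfl, rfl⟩⟩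
  have hF : Function.Bijective F := by
    constructor
    · intro a a' h
      have h' := congrArg Subtype.val h
      simp only [F, ES2.mk.injEq] at h'
      exact emb_inj h'.1
    · rintro ⟨⟨a, b, c, d⟩, hx⟩
      obtain ⟨h1, h2, h3, h4⟩ := (mem_Z_iff _).1 hx
      obtain ⟨e, rfl⟩ := exists_emb_of_red h1
      simp only at h2 h3 h4
      subst h2 h3 h4
      exact ⟨e, rfl⟩
  rw [← Nat.card_congr (Equiv.ofBijective F hF), Nat.card_zmod]

theorem eq_of_mem_Z {x : ES2 p m} (hx : x ∈ ZsetES2 p m) : ∃ c, x = ⟨emb p c, 0, 0, 0⟩ := by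
  obtain ⟨h1, h2, h3, h4⟩ := (mem_Z_iff _).1 hx
  obtain ⟨e, he⟩ := exists_emb_of_red h1
  exact ⟨e, ES2.ext he h2 h3 h4⟩

end ES2

open ES2

theorem ES2_endomorphism_images (p m : ℕ) [Fact p.Prime] (hodd : Odd p)
    (g : ES2 p m) :
    (g = 1 → {h | ∃ σ : ES2 p m →* ES2 p m, σ g = h} = {(1 : ES2 p m)}) ∧
    (g ∈ ZsetES2 p m → g ≠ 1 →
      {h | ∃ σ : ES2 p m →* ES2 p m, σ g = h} = ZsetES2 p m) ∧
    (g ∈ HsetES2 p m → g ∉ ZsetES2 p m →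
      {h | ∃ σ : ES2 p m →* ES2 p m, σ g = h} = HsetES2 p m) ∧
    (g ∉ HsetES2 p m →
      {h | ∃ σ : ES2 p m →* ES2 p m, σ g = h} = Set.univ) ∧
    Nat.card (ZsetES2 p m) = p ∧
    Nat.card (HsetES2 p m) = p ^ (2 * (m + 1)) ∧
    Nat.card (ES2 p m) = p ^ (2 * (m + 1) + 1) := by
  refine ⟨?_, ?_, ?_, ?_, card_Z, card_H, card_G⟩
  · rintro rfl
    ext h
    constructor
    · rintro ⟨σ, rfl⟩; simp
    · rintro rfl; exact ⟨MonoidHom.id _, rfl⟩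
  · intro hg hne
    obtain ⟨c, rfl⟩ := eq_of_mem_Z hg
    ext h
    constructor
    · rintro ⟨σ, rfl⟩
      obtain ⟨d, hd⟩ := red_surj c
      have hpow : (⟨emb p c, 0, 0, 0⟩ : ES2 p m) = (⟨d, 0, 0, 0⟩ : ES2 p m) ^ p := by
        rw [pow_p hodd, hd]
      rw [hpow, _root_.map_pow, pow_p hodd]
      exact (mem_Z_iff _).2 ⟨red_emb _, rfl, rfl, rfl⟩
    · intro hh
      obtain ⟨d, rfl⟩ := eq_of_mem_Z hh
      have hc : c ≠ 0 := by
        rintro rfl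
        apply hne
        rw [emb_zero]; rfl
      obtain ⟨k, hk⟩ := red_surj (d * c⁻¹)
      refine ⟨homA k, ?_⟩
      ext1
      · simp only [homA, MonoidHom.mk'_apply]
        rw [mul_comm, emb_mul_eq, hk, mul_comm, inv_mul_cancel_right₀ hc]
      · simp [homA]
      · rfl
      · rfl
  · intro hg hgZ
    ext h
    constructor
    · rintro ⟨σ, rfl⟩
      rw [mem_H_iff_pow hodd] at hg ⊢
      rw [← _root_.map_pow, hg, _root_.map_one]
    · intro hh
      rw [mem_Z_iff] at hgZ
      by_cases hu : g.u = 0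
      · by_cases hw1 : g.w1 = 0
        · have hw : g.w ≠ 0 := fun hw => hgZ ⟨(mem_H_iff _).1 hg, hu, hw1, hw⟩
          obtain ⟨i, hi⟩ := Function.ne_iff.1 hw
          exact exists_hom_of_functional hodd (fun x => x.w i) (fun _ _ => rfl) hi hh
        · exact exists_hom_of_functional hodd (fun x => x.w1) (fun _ _ => rfl) hw1 hh
      · obtain ⟨i, hi⟩ := Function.ne_iff.1 hu
        exact exists_hom_of_functional hodd (fun x => x.u i) (fun _ _ => rfl) hi hh
  · intro hg
    rw [mem_H_iff] at hg
    ext h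
    refine ⟨fun _ => trivial, fun _ => ?_⟩
    by_cases hh : h ∈ HsetES2 p m
    · exact exists_hom_of_functional hodd (fun x => red p x.u1) mul_red hg hh
    · rw [mem_H_iff] at hh
      obtain ⟨⟨σ, hσ⟩, -⟩ := reach_one hodd g hg
      obtain ⟨-, ⟨τ, hτ⟩⟩ := reach_one hodd h hh
      exact ⟨τ.comp σ, by simp [hσ, hτ]⟩
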